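/- Let d ≥ 2 and n be positive integers, t ∈ {1, d−1}, and n ≡ t (mod d). Then, as an identity of rational functions in the independent indeterminates a, b, c, q over ℚ, Σ_{k=0}^{(tn-1)/d} ((aq;q^d)_k (q/a;q^d)_k (q/b;q^d)_k / ((q^d;q^d)_k (c;q^d)_k (q^{d+3}/(bc);q^d)_k)) q^{dk} ≡ ((1−aq^{tn})(a−q^{tn}) / ((a−b)(1−ab))) · ((c/(aq);q^d)_{(tn-1)/d} (ac/q;q^d)_{(tn-1)/d}) / ((c;q^d)_{(tn-1)/d} (c/q^2;q^d)_{(tn-1)/d}) + ((b−q^{tn})(ab−1−a^2+aq^{tn}) / ((a−b)(1−ab))) · (q/b)^{(tn-1)/d} · ((bc/q;q^d)_{(tn-1)/d} (q^{d+2}/c;q^d)_{(tn-1)/d}) / ((c;q^d)_{(tn-1)/d} (q^{d+3}/(bc);q^d)_{(tn-1)/d}) modulo (1−aq^{tn})(a−q^{tn})(b−q^{tn}). -/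

import Mathlib

open Finset

/-- The `q`-shifted factorial `(x; q)_k = (1-x)(1-xq)⋯(1-xq^{k-1})`. -/
noncomputable def qPoch {K : Type*} [CommRing K] (x q : K) (k : ℕ) : K :=
  ∏ i ∈ Finset.range k, (1 - x * q ^ i)

/-- The polynomial ring `ℚ[a,b,c,q]` in four independent indeterminates. -/
abbrev R4 : Type := MvPolynomial (Fin 4) ℚ

/-- The fraction field `ℚ(a,b,c,q)`. -/
abbrev K4 : Type := FractionRing R4

/-- Congruence in `ℚ(a,b,c,q)` modulo a polynomial `P ∈ ℚ[a,b,c,q]`: `A ≡ B (mod P)`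
means `A - B = P * r / s` with `s` a nonzero polynomial coprime to `P`. -/
def congrK4 (A B : K4) (P : R4) : Prop :=
  ∃ r s : R4, s ≠ 0 ∧ IsRelPrime s P ∧
    A - B = algebraMap R4 K4 (P * r) / algebraMap R4 K4 s

noncomputable def aK : K4 := algebraMap R4 K4 (MvPolynomial.X 0)
noncomputable def bK : K4 := algebraMap R4 K4 (MvPolynomial.X 1)
noncomputable def cK : K4 := algebraMap R4 K4 (MvPolynomial.X 2)
noncomputable def qK : K4 := algebraMap R4 K4 (MvPolynomial.X 3)

section QSaalschutz

variable {K : Type*} [Field K]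

lemma qPoch_zero {R : Type*} [CommRing R] (x q : R) : qPoch x q 0 = 1 := by
  simp [qPoch]

lemma qPoch_succ {R : Type*} [CommRing R] (x q : R) (k : ℕ) :
    qPoch x q (k + 1) = qPoch x q k * (1 - x * q ^ k) := by
  simp [qPoch, Finset.prod_range_succ]

lemma qPoch_ne_zero {x q : K} (h : ∀ i, x * q ^ i ≠ 1) (k : ℕ) : qPoch x q k ≠ 0 :=
  Finset.prod_ne_zero_iff.2 fun i _ => sub_ne_zero.2 (h i).symm

/-- The summand of the `q`-Pfaff–Saalschütz sum in convolution form. -/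
noncomputable def saalTerm (A B D Q : K) (k l : ℕ) : K :=
  qPoch A Q k * qPoch B Q k * D ^ k * qPoch D Q l /
    (qPoch Q Q k * qPoch (A * B * D) Q k * qPoch Q Q l)

lemma sum_saalTerm_telescope {A B D Q : K} (hQ : ∀ i, Q * Q ^ i ≠ 1)
    (hC : ∀ i, A * B * D * Q ^ i ≠ 1) (N M : ℕ) (hM : M ≤ N) :
    ∑ k ∈ range (M + 1),
      ((1 - A * B * D * Q ^ N) * (1 - Q * Q ^ N) * saalTerm A B D Q k (N + 1 - k) -
        (1 - B * D * Q ^ N) * (1 - A * D * Q ^ N) * saalTerm A B D Q k (N - k)) =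
      -(Q ^ (N - M) * (1 - A * Q ^ M) * (1 - B * Q ^ M) * D * saalTerm A B D Q M (N - M)) := by
  have hQ' (k) : qPoch Q Q k ≠ 0 := qPoch_ne_zero hQ k
  have hC' (k) : qPoch (A * B * D) Q k ≠ 0 := qPoch_ne_zero hC k
  have hq (i) : 1 - Q * Q ^ i ≠ 0 := sub_ne_zero.2 (hQ i).symm
  have hc (i) : 1 - A * B * D * Q ^ i ≠ 0 := sub_ne_zero.2 (hC i).symm
  induction M with
  | zero =>
    have h1 := hQ' N
    have h2 := hq N
    simp only [zero_add, range_one, sum_singleton, Nat.sub_zero, saalTerm, qPoch_zero, qPoch_succ,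
      pow_zero]
    generalize 1 - Q * Q ^ N = X at *
    field_simp
    ring
  | succ M ih =>
    obtain ⟨j, rfl⟩ := Nat.exists_eq_add_of_le hM
    rw [sum_range_succ, ih (by omega)]
    have e1 : M + 1 + j + 1 - (M + 1) = j + 1 := by omega
    have e2 : M + 1 + j - (M + 1) = j := by omega
    have e3 : M + 1 + j - M = j + 1 := by omega
    have h1 := hQ' M
    have h2 := hC' M
    have h3 := hQ' j
    have h4 := hq M
    have h5 := hq j
    have h6 := hc M
    rw [e1, e2, e3]
    simp only [saalTerm, qPoch_succ]
    generalize qPoch A Q M = a at *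
    generalize qPoch B Q M = b at *
    generalize qPoch D Q j = e at *
    generalize qPoch Q Q M = f at *
    generalize qPoch Q Q j = g at *
    generalize qPoch (A * B * D) Q M = h at *
    simp only [pow_add, pow_one]
    generalize Q ^ M = u at *
    generalize Q ^ j = v at *
    generalize hX : 1 - Q * u = X at *
    generalize hY : 1 - Q * v = Y at *
    generalize hZ : 1 - A * B * D * u = Z at *
    field_simp
    rw [← hX, ← hY, ← hZ]
    ring

/-- The `q`-Pfaff–Saalschütz sum in convolution form. -/
lemma sum_saalTerm {A B D Q : K} (hQ : ∀ i, Q * Q ^ i ≠ 1)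
    (hC : ∀ i, A * B * D * Q ^ i ≠ 1) (N : ℕ) :
    ∑ k ∈ range (N + 1), saalTerm A B D Q k (N - k) =
      qPoch (B * D) Q N * qPoch (A * D) Q N / (qPoch (A * B * D) Q N * qPoch Q Q N) := by
  have hQ' (k) : qPoch Q Q k ≠ 0 := qPoch_ne_zero hQ k
  have hC' (k) : qPoch (A * B * D) Q k ≠ 0 := qPoch_ne_zero hC k
  have hq (i) : 1 - Q * Q ^ i ≠ 0 := sub_ne_zero.2 (hQ i).symm
  have hc (i) : 1 - A * B * D * Q ^ i ≠ 0 := sub_ne_zero.2 (hC i).symm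
  induction N with
  | zero => simp [saalTerm, qPoch_zero]
  | succ N ih =>
    have h1 := hQ' N
    have h2 := hC' N
    have h3 := hq N
    have h4 := hc N
    have key := sum_saalTerm_telescope hQ hC N N le_rfl
    rw [sum_sub_distrib, ← mul_sum, ← mul_sum, ih] at key
    have last : (1 - A * B * D * Q ^ N) * (1 - Q * Q ^ N) * saalTerm A B D Q (N + 1) 0 =
        Q ^ (N - N) * (1 - A * Q ^ N) * (1 - B * Q ^ N) * D * saalTerm A B D Q N (N - N) := by
      simp only [saalTerm, qPoch_succ, Nat.sub_self, qPoch_zero]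
      generalize 1 - Q * Q ^ N = X at *
      generalize 1 - A * B * D * Q ^ N = Y at *
      field_simp
      ring
    rw [sum_range_succ, Nat.sub_self]
    refine mul_left_cancel₀ (mul_ne_zero h4 h3) ?_
    rw [mul_add, last, eq_add_of_sub_eq key]
    simp only [qPoch_succ]
    generalize 1 - Q * Q ^ N = X at *
    generalize 1 - A * B * D * Q ^ N = Y at *
    field_simp
    ring

/-- Reversal of the first `k` factors of a `q`-shifted factorial. -/
lemma qPoch_reverse {y z Q : K} {N : ℕ} (h : y * z * Q ^ N = Q) (hQ : Q ≠ 0) (k : ℕ) (hk : k ≤ N) :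
    qPoch y Q k * z ^ k * (∏ i ∈ range k, Q ^ (N - 1 - i)) * qPoch z Q (N - k) =
      (-1) ^ k * qPoch z Q N := by
  induction k with
  | zero => simp [qPoch_zero]
  | succ k ih =>
    obtain ⟨j, rfl⟩ := Nat.exists_eq_add_of_le hk
    have e1 : k + 1 + j - k = j + 1 := by omega
    have e2 : k + 1 + j - (k + 1) = j := by omega
    have e3 : k + 1 + j - 1 - k = j := by omega
    have ih := ih (by omega)
    have hyz : y * Q ^ k * (z * Q ^ j) = 1 := by
      apply mul_right_cancel₀ hQ
      rw [one_mul]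
      nth_rw 4 [← h]
      ring
    rw [e1, qPoch_succ] at ih
    rw [e2, prod_range_succ, e3, qPoch_succ, pow_succ, pow_succ]
    linear_combination -ih - (qPoch y Q k * z ^ k * (∏ i ∈ range k, Q ^ (k + 1 + j - 1 - i)) *
      qPoch z Q j) * hyz

/-- The `q`-Pfaff–Saalschütz sum, with `x = Q ^ (-N)` and `E = Q ^ (1 - N) / D`. -/
lemma q_saalschuetz {A B C D E x Q : K} {N : ℕ} (hQ0 : Q ≠ 0) (hD0 : D ≠ 0)
    (hABD : A * B * D = C) (hx : x * Q ^ N = 1) (hE : E * D * Q ^ N = Q)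
    (hQ : ∀ i, Q * Q ^ i ≠ 1) (hC : ∀ i, C * Q ^ i ≠ 1) (hE1 : ∀ i, E * Q ^ i ≠ 1) :
    ∑ k ∈ range (N + 1), qPoch A Q k * qPoch B Q k * qPoch x Q k /
        (qPoch Q Q k * qPoch C Q k * qPoch E Q k) * Q ^ k =
      qPoch (B * D) Q N * qPoch (A * D) Q N / (qPoch C Q N * qPoch D Q N) := by
  subst hABD
  have hQ' (k) : qPoch Q Q k ≠ 0 := qPoch_ne_zero hQ k
  have hC' (k) : qPoch (A * B * D) Q k ≠ 0 := qPoch_ne_zero hC k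
  have hE' (k) : qPoch E Q k ≠ 0 := qPoch_ne_zero hE1 k
  have hW (k) : ∏ i ∈ range k, Q ^ (N - 1 - i) ≠ 0 :=
    prod_ne_zero_iff.2 fun _ _ => pow_ne_zero _ hQ0
  have hD' : qPoch D Q N ≠ 0 := by
    have h := qPoch_reverse hE hQ0 N le_rfl
    rw [Nat.sub_self, qPoch_zero, mul_one] at h
    intro h0
    rw [h0, mul_zero] at h
    exact mul_ne_zero (mul_ne_zero (hE' N) (pow_ne_zero _ hD0)) (hW N) h
  have key : ∀ k ∈ range (N + 1), qPoch A Q k * qPoch B Q k * qPoch x Q k /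
        (qPoch Q Q k * qPoch (A * B * D) Q k * qPoch E Q k) * Q ^ k =
      qPoch Q Q N / qPoch D Q N * saalTerm A B D Q k (N - k) := by
    intro k hk
    have hk : k ≤ N := Nat.lt_succ_iff.1 (mem_range.1 hk)
    have h1 := qPoch_reverse (y := x) (z := Q) (by rw [mul_right_comm, hx, one_mul]) hQ0 k hk
    have h2 := qPoch_reverse hE hQ0 k hk
    have cross : qPoch x Q k * Q ^ k * qPoch Q Q (N - k) * qPoch D Q N =
        qPoch E Q k * D ^ k * qPoch D Q (N - k) * qPoch Q Q N := by
      refine mul_left_cancel₀ (hW k) ?_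
      refine mul_left_cancel₀ (pow_ne_zero k (neg_ne_zero.2 (one_ne_zero (α := K)))) ?_
      linear_combination (-1) ^ k * qPoch D Q N * h1 - (-1) ^ k * qPoch Q Q N * h2
    have n1 := hQ' k
    have n2 := hC' k
    have n3 := hE' k
    have n4 := hQ' (N - k)
    simp only [saalTerm]
    rw [div_mul_eq_mul_div, div_mul_div_comm, div_eq_div_iff (by positivity) (by positivity)]
    linear_combination (qPoch A Q k * qPoch B Q k * qPoch Q Q k * qPoch (A * B * D) Q k) * cross
  rw [sum_congr rfl key, ← mul_sum, sum_saalTerm hQ hC]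
  have n1 := hQ' N
  have n2 := hC' N
  field_simp

end QSaalschutz

section Specialization

variable {K : Type*} [Field K]

/-- The truncated basic hypergeometric series of the congruence. -/
noncomputable def truncSum (a b c q : K) (d N : ℕ) : K :=
  ∑ k ∈ range (N + 1),
    qPoch (a * q) (q ^ d) k * qPoch (q / a) (q ^ d) k * qPoch (q / b) (q ^ d) k /
      (qPoch (q ^ d) (q ^ d) k * qPoch c (q ^ d) k *
        qPoch (q ^ (d + 3) / (b * c)) (q ^ d) k) * q ^ (d * k)

/-- The closed form to which the truncated series is congruent. -/
noncomputable def closedForm (a b c q : K) (d N m : ℕ) : K :=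
  (1 - a * q ^ m) * (a - q ^ m) / ((a - b) * (1 - a * b)) *
      ((qPoch (c / (a * q)) (q ^ d) N * qPoch (a * c / q) (q ^ d) N) /
        (qPoch c (q ^ d) N * qPoch (c / q ^ 2) (q ^ d) N)) +
    (b - q ^ m) * (a * b - 1 - a ^ 2 + a * q ^ m) / ((a - b) * (1 - a * b)) *
      ((q / b) ^ N *
        ((qPoch (b * c / q) (q ^ d) N * qPoch (q ^ (d + 2) / c) (q ^ d) N) /
          (qPoch c (q ^ d) N * qPoch (q ^ (d + 3) / (b * c)) (q ^ d) N)))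

/-- All denominators occurring in `truncSum` and `closedForm` are nonzero. -/
structure NonDegenerate (a b c q : K) (d : ℕ) : Prop where
  a_ne : a ≠ 0
  b_ne : b ≠ 0
  c_ne : c ≠ 0
  q_ne : q ≠ 0
  sub_ne : a - b ≠ 0
  one_sub_ne : 1 - a * b ≠ 0
  base_ne : ∀ i, q ^ d * (q ^ d) ^ i ≠ 1
  c_pow_ne : ∀ i, c * (q ^ d) ^ i ≠ 1
  c_div_pow_ne : ∀ i, c / q ^ 2 * (q ^ d) ^ i ≠ 1
  div_pow_ne : ∀ i, q ^ (d + 3) / (b * c) * (q ^ d) ^ i ≠ 1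

variable {a b c q : K} {d : ℕ}

lemma truncSum_eq_closedForm_of_b (h : NonDegenerate a b c q d) {N : ℕ}
    (hb : b = q ^ (d * N + 1)) : truncSum a b c q d N = closedForm a b c q d N (d * N + 1) := by
  obtain ⟨a0, b0, c0, q0, ab, ab1, hQ, hC, -, hE⟩ := h
  have S := q_saalschuetz (A := a * q) (B := q / a) (C := c) (D := c / q ^ 2)
    (E := q ^ (d + 3) / (b * c)) (x := q / b) (Q := q ^ d) (N := N) (pow_ne_zero _ q0)
    (div_ne_zero c0 (pow_ne_zero _ q0)) (by field_simp)
    (by rw [div_mul_eq_mul_div, div_eq_one_iff_eq b0, hb]; ring)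
    (by
      rw [div_mul_div_comm, div_mul_eq_mul_div,
        div_eq_iff (mul_ne_zero (mul_ne_zero b0 c0) (pow_ne_zero _ q0)), hb]
      ring) hQ hC hE
  have e1 : q / a * (c / q ^ 2) = c / (a * q) := by field_simp
  have e2 : a * q * (c / q ^ 2) = a * c / q := by field_simp
  rw [e1, e2] at S
  simp only [truncSum, closedForm, pow_mul]
  have e : (1 - a * b) * (a - b) / ((a - b) * (1 - a * b)) = 1 := by
    rw [mul_comm, div_self (mul_ne_zero ab ab1)]
  rw [S, ← hb, sub_self, zero_mul, zero_div, zero_mul, add_zero, e, one_mul]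

/-- The value of the series when one of the numerator parameters `α`, `β` terminates it. -/
lemma sum_of_terminating (b0 : b ≠ 0) (c0 : c ≠ 0) (q0 : q ≠ 0)
    (hQ : ∀ i, q ^ d * (q ^ d) ^ i ≠ 1) (hC : ∀ i, c * (q ^ d) ^ i ≠ 1)
    (hE : ∀ i, q ^ (d + 3) / (b * c) * (q ^ d) ^ i ≠ 1) {α β : K} {N : ℕ}
    (hαβ : α * β = q ^ 2) (hβ : β * (q ^ d) ^ N = 1) :
    ∑ k ∈ range (N + 1), qPoch α (q ^ d) k * qPoch (q / b) (q ^ d) k * qPoch β (q ^ d) k /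
        (qPoch (q ^ d) (q ^ d) k * qPoch c (q ^ d) k *
          qPoch (q ^ (d + 3) / (b * c)) (q ^ d) k) * (q ^ d) ^ k =
      (q / b) ^ N *
        ((qPoch (b * c / q) (q ^ d) N * qPoch (q ^ (d + 2) / c) (q ^ d) N) /
          (qPoch c (q ^ d) N * qPoch (q ^ (d + 3) / (b * c)) (q ^ d) N)) := by
  have α0 : α ≠ 0 := by
    rintro rfl
    rw [zero_mul] at hαβ
    exact pow_ne_zero 2 q0 hαβ.symm
  have Q0 : q ^ d ≠ 0 := pow_ne_zero _ q0
  have hED : q ^ (d + 3) / (b * c) * (b * c / (q * α)) * (q ^ d) ^ N = q ^ d := by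
    have e : q ^ (d + 3) / (b * c) * (b * c / (q * α)) = q ^ d * (q ^ 2 / α) := by
      field_simp
      ring
    rw [e, ← hαβ, mul_div_cancel_left₀ _ α0, mul_assoc, hβ, mul_one]
  have hyz : c / α * (q ^ (d + 2) / c) * (q ^ d) ^ N = q ^ d := by
    have e : c / α * (q ^ (d + 2) / c) = q ^ d * (q ^ 2 / α) := by
      field_simp
      ring
    rw [e, ← hαβ, mul_div_cancel_left₀ _ α0, mul_assoc, hβ, mul_one]
  have D0 : b * c / (q * α) ≠ 0 := div_ne_zero (mul_ne_zero b0 c0) (mul_ne_zero q0 α0)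
  rw [q_saalschuetz Q0 D0 (by field_simp) hβ hED hQ hC hE]
  have e1 : q / b * (b * c / (q * α)) = c / α := by field_simp
  have e2 : α * (b * c / (q * α)) = b * c / q := by field_simp
  rw [e1, e2]
  have r1 := qPoch_reverse hyz Q0 N le_rfl
  have r2 := qPoch_reverse ((congrArg (· * (q ^ d) ^ N) (mul_comm _ _)).trans hED) Q0 N le_rfl
  rw [Nat.sub_self, qPoch_zero, mul_one] at r1 r2
  have c' := qPoch_ne_zero hC N
  have E' := qPoch_ne_zero hE N
  have z0 : q ^ (d + 2) / c ≠ 0 := div_ne_zero (pow_ne_zero _ q0) c0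
  have hEz : q ^ (d + 3) / (b * c) = q / b * (q ^ (d + 2) / c) := by
    field_simp
    ring
  have D' : qPoch (b * c / (q * α)) (q ^ d) N ≠ 0 := by
    intro h
    rw [h, zero_mul, zero_mul] at r2
    exact mul_ne_zero (pow_ne_zero N (neg_ne_zero.2 one_ne_zero)) E' r2.symm
  have cross : qPoch (c / α) (q ^ d) N * qPoch (q ^ (d + 3) / (b * c)) (q ^ d) N =
      (q / b) ^ N * qPoch (q ^ (d + 2) / c) (q ^ d) N * qPoch (b * c / (q * α)) (q ^ d) N := by
    have hW : ∏ i ∈ range N, (q ^ d) ^ (N - 1 - i) ≠ 0 :=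
      prod_ne_zero_iff.2 fun _ _ => pow_ne_zero _ Q0
    refine mul_left_cancel₀ (mul_ne_zero (pow_ne_zero N (neg_ne_zero.2 (one_ne_zero (α := K))))
      (mul_ne_zero hW (pow_ne_zero N z0))) ?_
    have hp : (q ^ (d + 3) / (b * c)) ^ N = (q / b) ^ N * (q ^ (d + 2) / c) ^ N := by
      rw [hEz, mul_pow]
    rw [hp] at r2
    linear_combination (-1) ^ N * qPoch (q ^ (d + 3) / (b * c)) (q ^ d) N * r1 -
      (-1) ^ N * qPoch (q ^ (d + 2) / c) (q ^ d) N * r2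
  rw [← mul_div_assoc, div_eq_div_iff (mul_ne_zero c' D') (mul_ne_zero c' E')]
  linear_combination (qPoch (b * c / q) (q ^ d) N * qPoch c (q ^ d) N) * cross

lemma truncSum_eq_closedForm_of_a (h : NonDegenerate a b c q d) {N : ℕ}
    (ha : a = q ^ (d * N + 1) ∨ a * q ^ (d * N + 1) = 1) :
    truncSum a b c q d N = closedForm a b c q d N (d * N + 1) := by
  obtain ⟨a0, b0, c0, q0, ab, ab1, hQ, hC, -, hE⟩ := h
  have hαβ : a * q * (q / a) = q ^ 2 := by field_simp
  rcases ha with ha | ha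
  · have S := sum_of_terminating b0 c0 q0 hQ hC hE (N := N) hαβ
      (by rw [div_mul_eq_mul_div, div_eq_one_iff_eq a0, ha]; ring)
    have e : (b - a) * (a * b - 1 - a ^ 2 + a * a) / ((a - b) * (1 - a * b)) = 1 := by
      rw [div_eq_one_iff_eq (mul_ne_zero ab ab1)]
      ring
    rw [closedForm, ← ha, sub_self, mul_zero, zero_div, zero_mul, zero_add, e, one_mul, ← S,
      truncSum]
    refine sum_congr rfl fun k _ => ?_
    rw [pow_mul]
    ring
  · have S := sum_of_terminating b0 c0 q0 hQ hC hE (N := N) ((mul_comm _ _).trans hαβ)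
      (by rw [← ha]; ring)
    have e : (b - q ^ (d * N + 1)) * (a * b - 1 - a ^ 2 + a * q ^ (d * N + 1)) /
        ((a - b) * (1 - a * b)) = 1 := by
      rw [div_eq_one_iff_eq (mul_ne_zero ab ab1)]
      linear_combination (a - q ^ (d * N + 1)) * ha
    rw [closedForm, e, ha, sub_self, zero_mul, zero_div, zero_mul, zero_add, one_mul, ← S,
      truncSum]
    refine sum_congr rfl fun k _ => ?_
    rw [pow_mul]
    ring

end Specialization

section Specializes

variable {R K L : Type*} [CommRing R] [Field K] [Algebra R K] [Field L]

/-- `x` is a fraction over `R` whose denominator does not vanish under `φ : R →+* L`, and whose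
image under the induced map is `v`. -/
def SpecializesTo (φ : R →+* L) (x : K) (v : L) : Prop :=
  ∃ u s : R, φ s ≠ 0 ∧ x * algebraMap R K s = algebraMap R K u ∧ v * φ s = φ u

namespace SpecializesTo

variable {φ : R →+* L} {x y : K} {v w : L}

lemma of_algebraMap (r : R) : SpecializesTo φ (algebraMap R K r) (φ r) :=
  ⟨r, 1, by simp, by simp, by simp⟩

lemma one : SpecializesTo φ (1 : K) 1 := ⟨1, 1, by simp, by simp, by simp⟩

lemma zero : SpecializesTo φ (0 : K) 0 := ⟨0, 1, by simp, by simp, by simp⟩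

lemma add (hx : SpecializesTo φ x v) (hy : SpecializesTo φ y w) :
    SpecializesTo φ (x + y) (v + w) := by
  obtain ⟨u, s, hs, hu, hv⟩ := hx
  obtain ⟨u', s', hs', hu', hv'⟩ := hy
  refine ⟨u * s' + u' * s, s * s', by simp [hs, hs'], ?_, ?_⟩ <;>
    simp only [map_add, map_mul, ← hu, ← hu', ← hv, ← hv'] <;> ring

lemma sub (hx : SpecializesTo φ x v) (hy : SpecializesTo φ y w) :
    SpecializesTo φ (x - y) (v - w) := by
  obtain ⟨u, s, hs, hu, hv⟩ := hx
  obtain ⟨u', s', hs', hu', hv'⟩ := hy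
  refine ⟨u * s' - u' * s, s * s', by simp [hs, hs'], ?_, ?_⟩ <;>
    simp only [map_sub, map_mul, ← hu, ← hu', ← hv, ← hv'] <;> ring

lemma mul (hx : SpecializesTo φ x v) (hy : SpecializesTo φ y w) :
    SpecializesTo φ (x * y) (v * w) := by
  obtain ⟨u, s, hs, hu, hv⟩ := hx
  obtain ⟨u', s', hs', hu', hv'⟩ := hy
  refine ⟨u * u', s * s', by simp [hs, hs'], ?_, ?_⟩ <;>
    simp only [map_mul, ← hu, ← hu', ← hv, ← hv'] <;> ring

lemma div [FaithfulSMul R K] (hx : SpecializesTo φ x v) (hy : SpecializesTo φ y w) (hw : w ≠ 0) :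
    SpecializesTo φ (x / y) (v / w) := by
  obtain ⟨u, s, hs, hu, hv⟩ := hx
  obtain ⟨u', s', hs', hu', hv'⟩ := hy
  have hφ : φ u' ≠ 0 := hv' ▸ mul_ne_zero hw hs'
  have hy : y ≠ 0 := by
    rintro rfl
    rw [zero_mul, eq_comm, FaithfulSMul.algebraMap_eq_zero_iff] at hu'
    exact hφ (by rw [hu', map_zero])
  refine ⟨u * s', s * u', by simp [hs, hφ], ?_, ?_⟩ <;>
    simp only [map_mul, ← hu, ← hu', ← hv, ← hv'] <;> field_simp

lemma pow (hx : SpecializesTo φ x v) (n : ℕ) : SpecializesTo φ (x ^ n) (v ^ n) := by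
  obtain ⟨u, s, hs, hu, hv⟩ := hx
  exact ⟨u ^ n, s ^ n, by simp [hs], by simp [← hu, mul_pow], by simp [← hv, mul_pow]⟩

lemma sum {f : ℕ → K} {g : ℕ → L} (n : ℕ) (h : ∀ i, SpecializesTo φ (f i) (g i)) :
    SpecializesTo φ (∑ i ∈ range n, f i) (∑ i ∈ range n, g i) := by
  induction n with
  | zero => simpa using zero
  | succ n ih => simpa only [sum_range_succ] using ih.add (h n)

lemma qPoch (hx : SpecializesTo φ x v) (hy : SpecializesTo φ y w) (k : ℕ) :
    SpecializesTo φ (qPoch x y k) (qPoch v w k) := by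
  induction k with
  | zero => simpa only [qPoch_zero] using one
  | succ k ih => simpa only [qPoch_succ] using ih.mul (one.sub (hx.mul (hy.pow k)))

variable [FaithfulSMul R K] {a b c q : K} {α β γ κ : L} {d : ℕ}

lemma truncSum (ha : SpecializesTo φ a α) (hb : SpecializesTo φ b β) (hc : SpecializesTo φ c γ)
    (hq : SpecializesTo φ q κ) (h : NonDegenerate α β γ κ d) (N : ℕ) :
    SpecializesTo φ (truncSum a b c q d N) (truncSum α β γ κ d N) := by
  have hQ := hq.pow d
  refine sum _ fun k => (div ?_ ?_ ?_).mul (hq.pow _)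
  · exact (((ha.mul hq).qPoch hQ k).mul ((hq.div ha h.a_ne).qPoch hQ k)).mul
      ((hq.div hb h.b_ne).qPoch hQ k)
  · exact ((hQ.qPoch hQ k).mul (hc.qPoch hQ k)).mul
      (((hq.pow _).div (hb.mul hc) (mul_ne_zero h.b_ne h.c_ne)).qPoch hQ k)
  · exact mul_ne_zero (mul_ne_zero (qPoch_ne_zero h.base_ne k) (qPoch_ne_zero h.c_pow_ne k))
      (qPoch_ne_zero h.div_pow_ne k)

lemma closedForm (ha : SpecializesTo φ a α) (hb : SpecializesTo φ b β) (hc : SpecializesTo φ c γ)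
    (hq : SpecializesTo φ q κ) (h : NonDegenerate α β γ κ d) (N m : ℕ) :
    SpecializesTo φ (closedForm a b c q d N m) (closedForm α β γ κ d N m) := by
  have hQ := hq.pow d
  have hden := (ha.sub hb).mul (one.sub (ha.mul hb))
  have hden0 := mul_ne_zero h.sub_ne h.one_sub_ne
  have hC := qPoch_ne_zero h.c_pow_ne N
  refine (mul (div ?_ hden hden0) (div ?_ ?_ ?_)).add (mul (div ?_ hden hden0)
    (mul ((hq.div hb h.b_ne).pow N) (div ?_ ?_ ?_)))
  · exact (one.sub (ha.mul (hq.pow m))).mul (ha.sub (hq.pow m))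
  · exact ((hc.div (ha.mul hq) (mul_ne_zero h.a_ne h.q_ne)).qPoch hQ N).mul
      (((ha.mul hc).div hq h.q_ne).qPoch hQ N)
  · exact (hc.qPoch hQ N).mul ((hc.div (hq.pow 2) (pow_ne_zero _ h.q_ne)).qPoch hQ N)
  · exact mul_ne_zero hC (qPoch_ne_zero h.c_div_pow_ne N)
  · exact (hb.sub (hq.pow m)).mul ((((ha.mul hb).sub one).sub (ha.pow 2)).add (ha.mul (hq.pow m)))
  · exact (((hb.mul hc).div hq h.q_ne).qPoch hQ N).mul
      (((hq.pow _).div hc h.c_ne).qPoch hQ N)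
  · exact (hc.qPoch hQ N).mul
      (((hq.pow _).div (hb.mul hc) (mul_ne_zero h.b_ne h.c_ne)).qPoch hQ N)
  · exact mul_ne_zero hC (qPoch_ne_zero h.div_pow_ne N)

end SpecializesTo

/-- If the kernel of `φ` is generated by `p`, then `p` is prime. -/
lemma prime_of_map_eq_zero_iff_dvd {φ : R →+* L} {p : R} (hp0 : p ≠ 0)
    (hp : ∀ u, φ u = 0 ↔ p ∣ u) : Prime p := by
  refine ⟨hp0, fun hu => ?_, fun x y hxy => ?_⟩
  · exact one_ne_zero ((map_one φ).symm.trans ((hp 1).2 hu.dvd))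
  · rwa [← hp, map_mul, mul_eq_zero, hp, hp] at hxy

variable [IsDomain R] [UniqueFactorizationMonoid R] [IsFractionRing R K]

/-- A fraction which specializes to zero along finitely many maps with pairwise distinct principal
kernels is divisible by the product of their generators. -/
lemma exists_eq_prod_mul_div {ι : Type*} [Fintype ι] {φ : ι → R →+* L} {p : ι → R}
    (hp0 : ∀ i, p i ≠ 0) (hp : ∀ i u, φ i u = 0 ↔ p i ∣ u)
    (hpp : Pairwise fun i j => φ i (p j) ≠ 0) {x : K} (hx : ∀ i, SpecializesTo (φ i) x 0) :
    ∃ r s : R, s ≠ 0 ∧ IsRelPrime s (∏ i, p i) ∧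
      x = algebraMap R K ((∏ i, p i) * r) / algebraMap R K s := by
  obtain ⟨u, s, hus, rfl⟩ := IsFractionRing.exists_reduced_fraction (A := R) x
  have hprime i : Prime (p i) := prime_of_map_eq_zero_iff_dvd (hp0 i) (hp i)
  have hdvd i : p i ∣ u := by
    obtain ⟨u', s', hs', hu', h0⟩ := hx i
    rw [zero_mul, eq_comm, hp] at h0
    have hmul : u * s' = u' * s := by
      apply IsFractionRing.injective R K
      rw [map_mul, map_mul, ← hu', mul_right_comm, IsLocalization.mk'_spec]
    refine ((hprime i).dvd_or_dvd (hmul ▸ h0.mul_right _)).resolve_right fun h => hs' ((hp i _).2 h)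
  have hprod : ∏ i, p i ∣ u :=
    Finset.prod_dvd_of_isRelPrime (fun i _ j _ hij =>
      (hprime i).irreducible.isRelPrime_iff_not_dvd.2 fun h => hpp hij ((hp i _).2 h))
      fun i _ => hdvd i
  obtain ⟨r, rfl⟩ := hprod
  refine ⟨r, s, nonZeroDivisors.coe_ne_zero s, hus.symm.of_mul_right_left, ?_⟩
  rw [IsFractionRing.mk'_eq_div]

end Specializes

section Indeterminates

open MvPolynomial

/-- If every variable is congruent modulo `p`, up to powers of an element `e` invertible modulo `p`,
to a polynomial on which `φ` is the inclusion, then the kernel of `φ` is generated by `p`. -/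
lemma map_eq_zero_iff_dvd {σ k K : Type*} [Field k] [Field K] [Algebra k K]
    [Algebra (MvPolynomial σ k) K] [IsScalarTower k (MvPolynomial σ k) K]
    [FaithfulSMul (MvPolynomial σ k) K] {φ : MvPolynomial σ k →ₐ[k] K} {p e : MvPolynomial σ k}
    (he : IsCoprime p e) (hp : φ p = 0)
    (hφe : φ e = algebraMap _ K e)
    (hX : ∀ i, ∃ m y, p ∣ e ^ m * X i - y ∧ φ y = algebraMap _ K y) (u : MvPolynomial σ k) :
    φ u = 0 ↔ p ∣ u := by
  have key : ∃ m y, p ∣ e ^ m * u - y ∧ φ y = algebraMap _ K y := by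
    induction u using MvPolynomial.induction_on with
    | C r =>
      refine ⟨0, C r, by simp, ?_⟩
      rw [← MvPolynomial.algebraMap_eq, AlgHom.commutes, ← IsScalarTower.algebraMap_apply]
    | add f g hf hg =>
      obtain ⟨m, y, ⟨r, hr⟩, hy⟩ := hf
      obtain ⟨m', y', ⟨r', hr'⟩, hy'⟩ := hg
      refine ⟨m + m', e ^ m' * y + e ^ m * y', ⟨e ^ m' * r + e ^ m * r', ?_⟩, ?_⟩
      · linear_combination e ^ m' * hr + e ^ m * hr'
      · simp only [map_add, map_mul, map_pow, hφe, hy, hy']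
    | mul_X f i hf =>
      obtain ⟨m, y, ⟨r, hr⟩, hy⟩ := hf
      obtain ⟨m', y', ⟨r', hr'⟩, hy'⟩ := hX i
      refine ⟨m + m', y * y', ⟨r * (e ^ m' * X i) + y * r', ?_⟩, ?_⟩
      · linear_combination e ^ m' * X i * hr + y * hr'
      · simp only [map_mul, hy, hy']
  refine ⟨fun hu => ?_, fun ⟨r, hr⟩ => by rw [hr, map_mul, hp, zero_mul]⟩
  obtain ⟨m, y, ⟨r, hr⟩, hy⟩ := key
  have h0 : y = 0 := by
    have h := congrArg φ hr
    rw [map_sub, map_mul, hu, mul_zero, zero_sub, map_mul, hp, zero_mul, neg_eq_zero, hy] at h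
    exact (FaithfulSMul.algebraMap_eq_zero_iff _ _).1 h
  rw [h0, sub_zero] at hr
  exact he.pow_right.dvd_of_dvd_mul_left ⟨r, hr⟩

lemma algebraMap_ne_of_eval_ne {f g : R4} (w : Fin 4 → ℚ) (h : eval w f ≠ eval w g) :
    algebraMap R4 K4 f ≠ algebraMap R4 K4 g :=
  fun hfg => h (congrArg (eval w) (IsFractionRing.injective R4 K4 hfg))

/-- The substitution `a ↦ α`, `b ↦ β` that fixes `c` and `q`. -/
noncomputable def substAB (α β : K4) : R4 →ₐ[ℚ] K4 := aeval ![α, β, cK, qK]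

lemma qK_ne_zero : qK ≠ 0 := by
  simpa only [qK, map_zero] using algebraMap_ne_of_eval_ne (f := X 3) (g := 0) 1 (by simp)

lemma bK_ne_qK_pow (m : ℕ) : bK ≠ qK ^ m := by
  simpa only [bK, qK, map_mul, map_pow, map_one] using
    algebraMap_ne_of_eval_ne (f := X 1) (g := X 3 ^ m) ![1, 2, 1, 1] (by simp)

lemma aK_ne_qK_pow (m : ℕ) : aK ≠ qK ^ m := by
  simpa only [aK, qK, map_mul, map_pow, map_one] using
    algebraMap_ne_of_eval_ne (f := X 0) (g := X 3 ^ m) ![2, 1, 1, 1] (by simp)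

lemma qK_pow_mul_bK_ne_one (m : ℕ) : qK ^ m * bK ≠ 1 := by
  have h : algebraMap R4 K4 (X 3 ^ m * X 1) ≠ algebraMap R4 K4 1 :=
    algebraMap_ne_of_eval_ne ![1, 2, 1, 1] (by simp)
  simpa only [bK, qK, map_mul, map_pow, map_one] using h

lemma aK_mul_qK_pow_ne_one (m : ℕ) : aK * qK ^ m ≠ 1 := by
  have h : algebraMap R4 K4 (X 0 * X 3 ^ m) ≠ algebraMap R4 K4 1 :=
    algebraMap_ne_of_eval_ne ![2, 1, 1, 1] (by simp)
  simpa only [aK, qK, map_mul, map_pow, map_one] using h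

lemma qK_pow_ne_one {m : ℕ} (hm : m ≠ 0) : qK ^ m ≠ 1 := by
  have h : algebraMap R4 K4 (X 3 ^ m) ≠ algebraMap R4 K4 1 :=
    algebraMap_ne_of_eval_ne 2 (by simpa using (one_lt_pow₀ (one_lt_two (α := ℚ)) hm).ne')
  simpa only [qK, map_pow, map_one] using h

lemma nonDegenerate_of {α β : K4} {d : ℕ} (hd : d ≠ 0) (hα : α ≠ 0) (hαβ : α - β ≠ 0)
    (hαβ' : 1 - α * β ≠ 0) (hβ : β = bK ∨ ∃ m, β = qK ^ m) :
    NonDegenerate α β cK qK d := by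
  have c0 : cK ≠ 0 := by
    simpa only [cK, map_zero] using algebraMap_ne_of_eval_ne (f := X 2) (g := 0) 1 (by simp)
  have β0 : β ≠ 0 := by
    obtain rfl | ⟨m, rfl⟩ := hβ
    · simpa only [bK, map_zero] using algebraMap_ne_of_eval_ne (f := X 1) (g := 0) 1 (by simp)
    · exact pow_ne_zero _ qK_ne_zero
  refine ⟨hα, β0, c0, qK_ne_zero, hαβ, hαβ', fun i => ?_, fun i => ?_, fun i => ?_, fun i => ?_⟩
  · rw [← pow_succ', ← pow_mul]
    exact qK_pow_ne_one (mul_ne_zero hd i.succ_ne_zero)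
  · have h : algebraMap R4 K4 (X 2 * (X 3 ^ d) ^ i) ≠ algebraMap R4 K4 1 :=
      algebraMap_ne_of_eval_ne ![1, 1, 2, 1] (by simp)
    simpa only [cK, qK, map_mul, map_pow, map_one] using h
  · rw [div_mul_eq_mul_div, Ne, div_eq_one_iff_eq (pow_ne_zero _ qK_ne_zero)]
    have h : algebraMap R4 K4 (X 2 * (X 3 ^ d) ^ i) ≠ algebraMap R4 K4 (X 3 ^ 2) :=
      algebraMap_ne_of_eval_ne ![1, 1, 2, 1] (by simp)
    simpa only [cK, qK, map_mul, map_pow] using h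
  · rw [div_mul_eq_mul_div, Ne, div_eq_one_iff_eq (mul_ne_zero β0 c0)]
    obtain rfl | ⟨m, rfl⟩ := hβ
    · have h : algebraMap R4 K4 (X 3 ^ (d + 3) * (X 3 ^ d) ^ i) ≠ algebraMap R4 K4 (X 1 * X 2) :=
        algebraMap_ne_of_eval_ne ![1, 1, 2, 1] (by simp)
      simpa only [bK, cK, qK, map_mul, map_pow] using h
    · have h : algebraMap R4 K4 (X 3 ^ (d + 3) * (X 3 ^ d) ^ i) ≠
          algebraMap R4 K4 (X 3 ^ m * X 2) :=
        algebraMap_ne_of_eval_ne ![1, 1, 2, 1] (by simp)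
      simpa only [cK, qK, map_mul, map_pow] using h

lemma substAB_one_sub_eq_zero_iff (m : ℕ) (u : R4) :
    substAB (qK ^ m)⁻¹ bK u = 0 ↔ 1 - X 0 * X 3 ^ m ∣ u := by
  have hq : qK ^ m ≠ 0 := pow_ne_zero _ qK_ne_zero
  refine map_eq_zero_iff_dvd (e := X 3 ^ m) ⟨1, X 0, by ring⟩ ?_ (by simp [substAB, qK]) ?_ u
  · simp [substAB, hq]
  · intro i
    fin_cases i
    · exact ⟨1, 1, ⟨-1, by simp; ring⟩, by simp⟩
    · exact ⟨0, X 1, by simp, by simp [substAB, bK]⟩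
    · exact ⟨0, X 2, by simp, by simp [substAB, cK]⟩
    · exact ⟨0, X 3, by simp, by simp [substAB, qK]⟩

lemma substAB_X_zero_sub_eq_zero_iff (m : ℕ) (u : R4) :
    substAB (qK ^ m) bK u = 0 ↔ X 0 - X 3 ^ m ∣ u := by
  refine map_eq_zero_iff_dvd isCoprime_one_right ?_ (by simp) ?_ u
  · simp [substAB]
  · intro i
    fin_cases i
    · exact ⟨0, X 3 ^ m, by simp, by simp [substAB, qK]⟩
    · exact ⟨0, X 1, by simp, by simp [substAB, bK]⟩
    · exact ⟨0, X 2, by simp, by simp [substAB, cK]⟩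
    · exact ⟨0, X 3, by simp, by simp [substAB, qK]⟩

lemma substAB_X_one_sub_eq_zero_iff (m : ℕ) (u : R4) :
    substAB aK (qK ^ m) u = 0 ↔ X 1 - X 3 ^ m ∣ u := by
  refine map_eq_zero_iff_dvd isCoprime_one_right ?_ (by simp) ?_ u
  · simp [substAB]
  · intro i
    fin_cases i
    · exact ⟨0, X 0, by simp, by simp [substAB, aK]⟩
    · exact ⟨0, X 3 ^ m, by simp, by simp [substAB, qK]⟩
    · exact ⟨0, X 2, by simp, by simp [substAB, cK]⟩
    · exact ⟨0, X 3, by simp, by simp [substAB, qK]⟩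

lemma specializesTo_truncSum_sub_closedForm {α β : K4} {d N m : ℕ}
    (h : NonDegenerate α β cK qK d) (heq : truncSum α β cK qK d N = closedForm α β cK qK d N m) :
    SpecializesTo (substAB α β).toRingHom
      (truncSum aK bK cK qK d N - closedForm aK bK cK qK d N m) 0 := by
  have hX i : SpecializesTo (substAB α β).toRingHom (algebraMap R4 K4 (X i))
      (![α, β, cK, qK] i) := by
    have hi : (substAB α β).toRingHom (X i) = ![α, β, cK, qK] i := aeval_X _ i
    exact hi ▸ .of_algebraMap (X i)
  have ha : SpecializesTo (substAB α β).toRingHom aK α := hX 0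
  have hb : SpecializesTo (substAB α β).toRingHom bK β := hX 1
  have hc : SpecializesTo (substAB α β).toRingHom cK cK := hX 2
  have hq : SpecializesTo (substAB α β).toRingHom qK qK := hX 3
  rw [← sub_eq_zero.2 heq]
  exact (ha.truncSum hb hc hq h N).sub (ha.closedForm hb hc hq h N m)

lemma congrK4_truncSum_closedForm {d N m : ℕ} (hd : d ≠ 0) (hm : m = d * N + 1) :
    congrK4 (truncSum aK bK cK qK d N) (closedForm aK bK cK qK d N m)
      ((1 - X 0 * X 3 ^ m) * (X 0 - X 3 ^ m) * (X 1 - X 3 ^ m)) := by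
  have hq : qK ^ m ≠ 0 := pow_ne_zero _ qK_ne_zero
  have nd₁ : NonDegenerate (qK ^ m)⁻¹ bK cK qK d := by
    refine nonDegenerate_of hd (inv_ne_zero hq) (sub_ne_zero.2 fun h => ?_)
      (sub_ne_zero.2 fun h => ?_) (Or.inl rfl)
    · exact qK_pow_mul_bK_ne_one m (by rw [← h, mul_inv_cancel₀ hq])
    · exact bK_ne_qK_pow m (by field_simp at h; exact h.symm)
  have nd₂ : NonDegenerate (qK ^ m) bK cK qK d :=
    nonDegenerate_of hd hq (sub_ne_zero.2 (bK_ne_qK_pow m).symm)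
      (sub_ne_zero.2 (qK_pow_mul_bK_ne_one m).symm) (Or.inl rfl)
  have nd₃ : NonDegenerate aK (qK ^ m) cK qK d :=
    nonDegenerate_of hd
      (by simpa only [aK, map_zero] using algebraMap_ne_of_eval_ne (f := X 0) (g := 0) 1 (by simp))
      (sub_ne_zero.2 (aK_ne_qK_pow m)) (sub_ne_zero.2 (aK_mul_qK_pow_ne_one m).symm)
      (Or.inr ⟨m, rfl⟩)
  have key := exists_eq_prod_mul_div
    (x := truncSum aK bK cK qK d N - closedForm aK bK cK qK d N m)
    (φ := ![(substAB (qK ^ m)⁻¹ bK).toRingHom, (substAB (qK ^ m) bK).toRingHom,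
      (substAB aK (qK ^ m)).toRingHom])
    (p := ![1 - X 0 * X 3 ^ m, X 0 - X 3 ^ m, X 1 - X 3 ^ m]) ?_ ?_ ?_ ?_
  · rwa [Fin.prod_univ_three] at key
  · intro i h
    have h := congrArg (eval ![2, 2, 1, 1]) h
    fin_cases i <;> simp at h <;> norm_num at h
  · intro i u
    fin_cases i
    · exact substAB_one_sub_eq_zero_iff m u
    · exact substAB_X_zero_sub_eq_zero_iff m u
    · exact substAB_X_one_sub_eq_zero_iff m u
  · have hqq : qK ^ m * qK ^ m ≠ 1 := by
      rw [← pow_add]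
      exact qK_pow_ne_one (by omega)
    intro i j hij
    fin_cases i <;> fin_cases j
    · exact absurd rfl hij
    · simpa [substAB, sub_eq_zero, ← mul_eq_one_iff_inv_eq₀ hq] using hqq
    · simpa [substAB, sub_eq_zero] using bK_ne_qK_pow m
    · simpa [substAB, sub_eq_zero] using hqq.symm
    · exact absurd rfl hij
    · simpa [substAB, sub_eq_zero] using bK_ne_qK_pow m
    · simpa [substAB, sub_eq_zero] using (aK_mul_qK_pow_ne_one m).symm
    · simpa [substAB, sub_eq_zero] using aK_ne_qK_pow m
    · exact absurd rfl hij
  · intro i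
    fin_cases i
    · refine specializesTo_truncSum_sub_closedForm nd₁ ?_
      subst hm
      exact truncSum_eq_closedForm_of_a nd₁ (Or.inr (inv_mul_cancel₀ hq))
    · refine specializesTo_truncSum_sub_closedForm nd₂ ?_
      subst hm
      exact truncSum_eq_closedForm_of_a nd₂ (Or.inl rfl)
    · refine specializesTo_truncSum_sub_closedForm nd₃ ?_
      subst hm
      exact truncSum_eq_closedForm_of_b nd₃ rfl

end Indeterminates

lemma mul_mod_eq_one_of_mod_eq {d n t : ℕ} (hd : 2 ≤ d) (ht : t = 1 ∨ t = d - 1)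
    (hmod : n % d = t) : t * n % d = 1 := by
  rw [Nat.mul_mod, hmod]
  obtain rfl | rfl := ht
  · simp [Nat.mod_eq_of_lt hd]
  · obtain ⟨e, rfl⟩ := Nat.exists_eq_add_of_le hd
    have h : (2 + e - 1) * (2 + e - 1) = 1 + (2 + e) * e := by
      rw [show 2 + e - 1 = e + 1 by omega]
      ring
    rw [Nat.mod_eq_of_lt (by omega : 2 + e - 1 < 2 + e), h, Nat.add_mul_mod_self_left,
      Nat.mod_eq_of_lt (by omega)]

theorem stmt3 (d n t : ℕ) (hd : 2 ≤ d) (hn : 0 < n) (ht : t = 1 ∨ t = d - 1)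
    (hmod : n % d = t) :
    congrK4
      (∑ k ∈ Finset.range ((t * n - 1) / d + 1),
        qPoch (aK * qK) (qK ^ d) k * qPoch (qK / aK) (qK ^ d) k *
          qPoch (qK / bK) (qK ^ d) k /
          (qPoch (qK ^ d) (qK ^ d) k * qPoch cK (qK ^ d) k *
            qPoch (qK ^ (d + 3) / (bK * cK)) (qK ^ d) k) * qK ^ (d * k))
      ((1 - aK * qK ^ (t * n)) * (aK - qK ^ (t * n)) / ((aK - bK) * (1 - aK * bK)) *
          ((qPoch (cK / (aK * qK)) (qK ^ d) ((t * n - 1) / d) *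
            qPoch (aK * cK / qK) (qK ^ d) ((t * n - 1) / d)) /
            (qPoch cK (qK ^ d) ((t * n - 1) / d) *
              qPoch (cK / qK ^ 2) (qK ^ d) ((t * n - 1) / d))) +
        (bK - qK ^ (t * n)) * (aK * bK - 1 - aK ^ 2 + aK * qK ^ (t * n)) /
            ((aK - bK) * (1 - aK * bK)) *
          ((qK / bK) ^ ((t * n - 1) / d) *
            ((qPoch (bK * cK / qK) (qK ^ d) ((t * n - 1) / d) *
              qPoch (qK ^ (d + 2) / cK) (qK ^ d) ((t * n - 1) / d)) /
              (qPoch cK (qK ^ d) ((t * n - 1) / d) *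
                qPoch (qK ^ (d + 3) / (bK * cK)) (qK ^ d) ((t * n - 1) / d)))))
      ((1 - MvPolynomial.X 0 * MvPolynomial.X 3 ^ (t * n)) *
        (MvPolynomial.X 0 - MvPolynomial.X 3 ^ (t * n)) *
        (MvPolynomial.X 1 - MvPolynomial.X 3 ^ (t * n))) := by
  have hone := mul_mod_eq_one_of_mod_eq hd ht hmod
  have hm : t * n = d * ((t * n - 1) / d) + 1 := by
    have h := Nat.div_add_mod (t * n) d
    rw [hone] at h
    have hsub : t * n - 1 = d * (t * n / d) := by omega
    rw [hsub, Nat.mul_div_cancel_left _ (by omega)]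
    exact h.symm
  exact congrK4_truncSum_closedForm (by omega) hm
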